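/- arXiv:0709.0975 — 2 statements merged into one kernel-verified Lean document; each statement's English description precedes it below -/
import Mathlib

section
/- Let G be a finite abelian group with minimal number of generators r, and suppose either r < n, or the smallest invariant factor of G is at most 4. Then GLₙ(ℤ) acts transitively on the set of generating n-tuples of G. -/
namespace Stmt6

/-- the right action of integer matrices on tuples -/
def act {G : Type*} [CommGroup G] {n : ℕ} (σ : Fin n → G) (P : Matrix (Fin n) (Fin n) ℤ) :
    Fin n → G := fun j => ∏ i, σ i ^ P i j

/-- equivalence under unimodular matrices -/
def E {G : Type*} [CommGroup G] {n : ℕ} (σ σ' : Fin n → G) : Prop :=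
  ∃ P : Matrix (Fin n) (Fin n) ℤ, IsUnit P.det ∧ act σ P = σ'

variable {G : Type*} [CommGroup G] {n : ℕ}

theorem act_one (σ : Fin n → G) : act σ 1 = σ := by
  funext j
  unfold act
  rw [Finset.prod_eq_single j]
  · simp
  · intro b _ hb
    simp [Matrix.one_apply_ne hb]
  · simp

theorem act_mul (σ : Fin n → G) (P Q : Matrix (Fin n) (Fin n) ℤ) :
    act σ (P * Q) = act (act σ P) Q := by
  funext j
  unfold act
  have h1 : ∀ i, σ i ^ (P * Q) i j = ∏ k, σ i ^ (P i k * Q k j) := by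
    intro i
    rw [Matrix.mul_apply]
    generalize (Finset.univ : Finset (Fin n)) = A
    induction A using Finset.induction_on with
    | empty => simp
    | insert a A ha ih => rw [Finset.sum_insert ha, Finset.prod_insert ha, zpow_add, ih]
  simp_rw [h1]
  rw [Finset.prod_comm]
  refine Finset.prod_congr rfl fun k _ => ?_
  rw [← Finset.prod_zpow]
  refine Finset.prod_congr rfl fun i _ => ?_
  rw [zpow_mul]

theorem E.refl (σ : Fin n → G) : E σ σ := ⟨1, by simp, act_one σ⟩

theorem E.trans {σ σ' σ'' : Fin n → G} (h : E σ σ') (h' : E σ' σ'') : E σ σ'' := by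
  obtain ⟨P, hP, rfl⟩ := h
  obtain ⟨Q, hQ, rfl⟩ := h'
  exact ⟨P * Q, by rw [Matrix.det_mul]; exact hP.mul hQ, act_mul _ _ _⟩

theorem E.symm {σ σ' : Fin n → G} (h : E σ σ') : E σ' σ := by
  obtain ⟨P, hP, rfl⟩ := h
  refine ⟨P⁻¹, Matrix.isUnit_nonsing_inv_det _ hP, ?_⟩
  rw [← act_mul, Matrix.mul_nonsing_inv _ hP, act_one]

theorem E.closure_le {σ σ' : Fin n → G} (h : E σ σ') :
    Subgroup.closure (Set.range σ') ≤ Subgroup.closure (Set.range σ) := by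
  obtain ⟨P, hP, rfl⟩ := h
  rw [Subgroup.closure_le]
  rintro _ ⟨j, rfl⟩
  exact Subgroup.prod_mem _ fun i _ =>
    Subgroup.zpow_mem _ (Subgroup.subset_closure (Set.mem_range_self i)) _

theorem E.closure_eq {σ σ' : Fin n → G} (h : E σ σ') :
    Subgroup.closure (Set.range σ') = Subgroup.closure (Set.range σ) :=
  le_antisymm h.closure_le h.symm.closure_le

/-- block lower triangular matrix -/
def bl (c : ℤ) (v : Fin n → ℤ) (P : Matrix (Fin n) (Fin n) ℤ) :
    Matrix (Fin (n + 1)) (Fin (n + 1)) ℤ :=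
  Matrix.of (Fin.cons (Fin.cons c 0) (fun i => Fin.cons (v i) (P i)))

theorem det_bl (c : ℤ) (v : Fin n → ℤ) (P : Matrix (Fin n) (Fin n) ℤ) :
    (bl c v P).det = c * P.det := by
  rw [Matrix.det_succ_row_zero, Fin.sum_univ_succ]
  have : (bl c v P).submatrix Fin.succ (Fin.succAbove 0) = P := by
    ext i j
    simp [bl]
  rw [this]
  simp [bl]

theorem act_bl (c : ℤ) (v : Fin n → ℤ) (P : Matrix (Fin n) (Fin n) ℤ) (x : G) (s : Fin n → G) :
    act (Fin.cons x s) (bl c v P) = Fin.cons (x ^ c * ∏ i, s i ^ v i) (act s P) := by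
  funext j
  refine Fin.cases ?_ (fun j => ?_) j
  · simp [act, bl, Fin.prod_univ_succ]
  · simp [act, bl, Fin.prod_univ_succ]

theorem E.cons {s s' : Fin n → G} (x : G) (h : E s s') :
    E (Fin.cons x s : Fin (n + 1) → G) (Fin.cons x s') := by
  obtain ⟨P, hP, rfl⟩ := h
  exact ⟨bl 1 0 P, by simpa [det_bl] using hP, by simp [act_bl]⟩

theorem E.transv {s : Fin n → G} (x y : G) (hy : y ∈ Subgroup.closure (Set.range s)) :
    E (Fin.cons x s : Fin (n + 1) → G) (Fin.cons (x * y) s) := by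
  obtain ⟨v, hv⟩ : ∃ v : Fin n → ℤ, ∏ i, s i ^ v i = y := by
    induction hy using Subgroup.closure_induction with
    | mem x hx =>
      obtain ⟨i, rfl⟩ := hx
      exact ⟨fun k => (1 : Matrix (Fin n) (Fin n) ℤ) k i, congrFun (act_one s) i⟩
    | one => exact ⟨0, by simp⟩
    | mul x y _ _ hx hy =>
      obtain ⟨v, rfl⟩ := hx
      obtain ⟨w, rfl⟩ := hy
      exact ⟨v + w, by simp [zpow_add, Finset.prod_mul_distrib]⟩
    | inv x _ hx =>
      obtain ⟨v, rfl⟩ := hx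
      exact ⟨-v, by simp⟩
  exact ⟨bl 1 v 1, by simp [det_bl], by simp [act_bl, act_one, hv]⟩

/-- two by two move -/
def tw (n : ℕ) (p q r t : ℤ) : Matrix (Fin (n + 2)) (Fin (n + 2)) ℤ :=
  Matrix.of (Fin.cons (Fin.cons p (Fin.cons r 0))
    (Fin.cons (Fin.cons q (Fin.cons t 0))
      (fun i => Fin.cons 0 (Fin.cons 0 ((1 : Matrix (Fin n) (Fin n) ℤ) i)))))

theorem det_tw (p q r t : ℤ) : (tw n p q r t).det = p * t - q * r := by
  rw [Matrix.det_succ_column_zero, Fin.sum_univ_succ, Fin.sum_univ_succ]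
  have h1 : (tw n p q r t).submatrix (Fin.succAbove 0) Fin.succ = bl t 0 1 := by
    ext i j
    refine Fin.cases ?_ (fun i => ?_) i <;> refine Fin.cases ?_ (fun j => ?_) j <;> simp [tw, bl]
  have h2 : (tw n p q r t).submatrix (Fin.succAbove (Fin.succ 0)) Fin.succ = bl r 0 1 := by
    ext i j
    refine Fin.cases ?_ (fun i => ?_) i <;> refine Fin.cases ?_ (fun j => ?_) j <;>
      simp [tw, bl]
  rw [h1, h2, det_bl, det_bl]
  simp [tw]
  ring

theorem E.two {s : Fin n → G} (x y : G) (p q r t : ℤ) (h : p * t - q * r = 1) :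
    E (Fin.cons x (Fin.cons y s) : Fin (n + 2) → G)
      (Fin.cons (x ^ p * y ^ q) (Fin.cons (x ^ r * y ^ t) s)) := by
  refine ⟨tw n p q r t, by simp [det_tw, h], ?_⟩
  funext j
  refine Fin.cases ?_ (fun j => Fin.cases ?_ (fun j => ?_) j) j
  · simp [act, tw, Fin.prod_univ_succ]
  · simp [act, tw, Fin.prod_univ_succ]
  · have := congrFun (act_one s) j
    simpa [act, tw, Fin.prod_univ_succ] using this

theorem reduce (t : G) (H : Subgroup G) : ∀ (n : ℕ) (σ : Fin (n + 1) → G),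
    (∀ i, ∃ a : ℤ, ∃ h ∈ H, σ i = t ^ a * h) →
    ∃ x : G, ∃ s : Fin n → G, (∀ i, s i ∈ H) ∧ (∃ a : ℤ, ∃ h ∈ H, x = t ^ a * h) ∧
      E σ (Fin.cons x s) := by
  intro n
  induction n with
  | zero =>
    intro σ hσ
    refine ⟨σ 0, Fin.tail σ, fun i => i.elim0, hσ 0, ?_⟩
    rw [show (Fin.cons (σ 0) (Fin.tail σ) : Fin 1 → G) = σ from Fin.cons_self_tail σ]
    exact E.refl _
  | succ n ih =>
    intro σ hσ
    obtain ⟨y, s, hs, ⟨b, k, hk, rfl⟩, hE⟩ := ih (Fin.tail σ) (fun i => hσ i.succ)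
    obtain ⟨a, h, hh, hx⟩ := hσ 0
    have hE1 : E σ (Fin.cons (t ^ a * h) (Fin.cons (t ^ b * k) s)) := by
      have := hE.cons (σ 0)
      rw [show (Fin.cons (σ 0) (Fin.tail σ) : Fin (n + 2) → G) = σ from
        Fin.cons_self_tail σ] at this
      rwa [hx] at this
    by_cases hab : Int.gcd a b = 0
    · rw [Int.gcd_eq_zero_iff] at hab
      obtain ⟨rfl, rfl⟩ := hab
      refine ⟨_, _, ?_, ⟨0, h, hh, rfl⟩, hE1⟩
      intro i
      refine Fin.cases ?_ (fun i => ?_) i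
      · simpa using hk
      · simpa using hs i
    · obtain ⟨a', ha'⟩ := Int.gcd_dvd_left a b
      obtain ⟨b', hb'⟩ := Int.gcd_dvd_right a b
      have hg : (Int.gcd a b : ℤ) ≠ 0 := by exact_mod_cast hab
      have hbez := Int.gcd_eq_gcd_ab a b
      generalize (Int.gcd a b : ℤ) = g at *
      generalize Int.gcdA a b = p at *
      generalize Int.gcdB a b = q at *
      have hdet : p * a' - q * (-b') = 1 := by
        apply mul_left_cancel₀ hg
        subst ha' hb'
        linear_combination -hbez
      refine ⟨_, _, ?_, ?_, hE1.trans (E.two _ _ p q (-b') a' hdet)⟩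
      · intro i
        refine Fin.cases ?_ (fun i => ?_) i
        · have : (t ^ a * h) ^ (-b') * (t ^ b * k) ^ a' = h ^ (-b') * k ^ a' := by
            rw [mul_zpow, mul_zpow, mul_mul_mul_comm, ← zpow_mul, ← zpow_mul, ← zpow_add]
            have : a * -b' + b * a' = 0 := by rw [ha', hb']; ring
            rw [this]; simp
          simp only [Fin.cons_zero]
          rw [this]
          exact H.mul_mem (H.zpow_mem hh _) (H.zpow_mem hk _)
        · simpa using hs i
      · refine ⟨a * p + b * q, h ^ p * k ^ q, H.mul_mem (H.zpow_mem hh _) (H.zpow_mem hk _), ?_⟩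
        rw [mul_zpow, mul_zpow, mul_mul_mul_comm, ← zpow_mul, ← zpow_mul, ← zpow_add]

theorem range_cons_closure (x : G) (s : Fin n → G) :
    Subgroup.closure (Set.range (Fin.cons x s : Fin (n + 1) → G)) =
      Subgroup.zpowers x ⊔ Subgroup.closure (Set.range s) := by
  rw [Fin.range_cons, Set.insert_eq, Subgroup.closure_union, Subgroup.zpowers_eq_closure]

/-- `τ` padded by ones -/
def pad (r n : ℕ) (τ : Fin r → G) : Fin n → G :=
  fun i => if h : (i : ℕ) < r then τ ⟨i, h⟩ else 1

theorem small (m : ℕ) (hm : m ≤ 4) (h1 : m ≠ 1) (u k : ℤ) (h : (m : ℤ) ∣ u * k - 1) :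
    (m : ℤ) ∣ u - 1 ∨ (m : ℤ) ∣ u + 1 := by
  have hc : IsCoprime u (m : ℤ) := by
    obtain ⟨c, hc⟩ := h
    exact ⟨k, -c, by linear_combination hc⟩
  interval_cases m
  · have : IsUnit u := isCoprime_zero_right.1 (by simpa using hc)
    rcases Int.isUnit_iff.1 this with rfl | rfl <;> simp
  · omega
  · have : ¬ (2 : ℤ) ∣ u := fun hd => by
      have := hc.isUnit_of_dvd' hd (by norm_num)
      rw [Int.isUnit_iff] at this; omega
    push_cast; omega
  · have : ¬ (3 : ℤ) ∣ u := fun hd => by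
      have := hc.isUnit_of_dvd' hd (by norm_num)
      rw [Int.isUnit_iff] at this; omega
    push_cast; omega
  · have : ¬ (2 : ℤ) ∣ u := fun hd => by
      have := hc.isUnit_of_dvd' hd (by norm_num)
      rw [Int.isUnit_iff] at this; omega
    push_cast; omega

theorem main : ∀ (r n : ℕ) (_ : r ≤ n) (τ : Fin r → G)
    (_ : iSupIndep fun i => Subgroup.zpowers (τ i))
    (_ : ∀ i, τ i ≠ 1)
    (_ : ∀ i j : Fin r, i ≤ j → orderOf (τ j) ∣ orderOf (τ i))
    (_ : r < n ∨ r = 0 ∨ ∃ i : Fin r, (i : ℕ) + 1 = r ∧ orderOf (τ i) ≤ 4)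
    (σ : Fin n → G) (_ : Subgroup.closure (Set.range σ) = ⨆ i, Subgroup.zpowers (τ i)),
    E σ (pad r n τ) := by
  intro r
  induction r with
  | zero =>
    intro n _ τ _ _ _ _ σ hσ
    have : σ = pad 0 n τ := by
      funext i
      have : σ i ∈ Subgroup.closure (Set.range σ) := Subgroup.subset_closure ⟨i, rfl⟩
      rw [hσ, iSup_of_empty, Subgroup.mem_bot] at this
      simpa [pad] using this
    rw [← this]
    exact E.refl _
  | succ r ih =>
    intro n hn τ hind hnt hdvd hcase σ hσ
    obtain ⟨n, rfl⟩ : ∃ k, n = k + 1 := ⟨n - 1, by omega⟩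
    set t := τ 0 with ht
    set H : Subgroup G := ⨆ i : Fin r, Subgroup.zpowers (τ i.succ) with hH
    set m := orderOf t with hm
    have hsplit : (⨆ i, Subgroup.zpowers (τ i)) = Subgroup.zpowers t ⊔ H := by
      refine le_antisymm (iSup_le fun i => ?_) (sup_le (le_iSup (fun i => Subgroup.zpowers (τ i)) 0) (iSup_le fun i => le_iSup (fun i => Subgroup.zpowers (τ i)) i.succ))
      refine Fin.cases le_sup_left (fun i => ?_) i
      exact le_sup_of_le_right (le_iSup (fun i : Fin r => Subgroup.zpowers (τ i.succ)) i)
    have hdisj : Disjoint (Subgroup.zpowers t) H := by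
      refine (hind 0).mono_right (iSup_le fun i => ?_)
      exact le_iSup₂_of_le i.succ (Fin.succ_ne_zero i) le_rfl
    have hexp : ∀ h ∈ H, h ^ m = 1 := by
      have : H ≤ (powMonoidHom m : G →* G).ker := by
        refine iSup_le fun i => ?_
        rw [Subgroup.zpowers_le, MonoidHom.mem_ker, powMonoidHom_apply]
        exact orderOf_dvd_iff_pow_eq_one.1 (hdvd 0 i.succ (Fin.zero_le _))
      exact fun h hh => this hh
    have hcan : ∀ (a : ℤ), t ^ a ∈ H → (m : ℤ) ∣ a := by
      intro a ha
      rw [hm, orderOf_dvd_iff_zpow_eq_one]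
      exact Subgroup.disjoint_def.1 hdisj (Subgroup.zpow_mem_zpowers _ _) ha
    rw [hsplit] at hσ
    obtain ⟨x, s, hs, ⟨u, h, hh, rfl⟩, hE⟩ := reduce t H n σ (by
      intro i
      have : σ i ∈ Subgroup.closure (Set.range σ) := Subgroup.subset_closure ⟨i, rfl⟩
      rw [hσ, Subgroup.mem_sup] at this
      obtain ⟨y, ⟨a, rfl⟩, z, hz, e⟩ := this
      exact ⟨a, z, hz, e.symm⟩)
    have hsH : ∀ {k : ℕ} {s : Fin k → G}, (∀ i, s i ∈ H) →
        Subgroup.closure (Set.range s) ≤ H := by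
      intro k s hs
      rw [Subgroup.closure_le]
      rintro _ ⟨i, rfl⟩
      exact hs i
    obtain ⟨k, hk⟩ : ∃ k : ℤ, (m : ℤ) ∣ u * k - 1 := by
      have h1 : t ∈ Subgroup.zpowers t ⊔ H := Subgroup.mem_sup_left (Subgroup.mem_zpowers t)
      rw [← hσ, ← hE.closure_eq, range_cons_closure, Subgroup.mem_sup] at h1
      obtain ⟨y, ⟨k, rfl⟩, z, hz, e⟩ := h1
      refine ⟨k, hcan _ ?_⟩
      have hz' := hsH hs hz
      have : t ^ (u * k - 1) = (h ^ k * z)⁻¹ := by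
        simp only at e
        rw [zpow_sub, zpow_mul, zpow_one]
        nth_rewrite 2 [← e]
        rw [mul_zpow, mul_assoc, mul_inv, mul_inv_cancel_left]
      rw [this]
      exact H.inv_mem (H.mul_mem (H.zpow_mem hh _) hz')
    obtain ⟨h', hh', s', hs', hE'⟩ : ∃ h' ∈ H, ∃ s' : Fin n → G, (∀ i, s' i ∈ H) ∧
        E σ (Fin.cons (t * h') s') := by
      rcases Nat.eq_zero_or_pos n with rfl | hnpos
      · obtain rfl : r = 0 := by omega
        have h4 : m ≤ 4 := by
          rcases hcase with h | h | ⟨i, _, hi⟩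
          · omega
          · omega
          · rwa [Fin.fin_one_eq_zero i] at hi
        have h1 : m ≠ 1 := fun e => hnt 0 (orderOf_eq_one_iff.1 e)
        rcases small m h4 h1 u k hk with hd | hd
        · refine ⟨h, hh, s, hs, ?_⟩
          rw [hm, orderOf_dvd_iff_zpow_eq_one, zpow_sub, zpow_one, mul_inv_eq_one] at hd
          rwa [hd] at hE
        · refine ⟨h⁻¹, H.inv_mem hh, s, hs, hE.trans ?_⟩
          rw [hm, orderOf_dvd_iff_zpow_eq_one, zpow_add, zpow_one, mul_eq_one_iff_eq_inv] at hd
          refine ⟨bl (-1) 0 1, by rw [det_bl]; simp, ?_⟩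
          rw [act_bl, act_one]
          simp [hd, mul_comm]
      · obtain ⟨n, rfl⟩ : ∃ k, n = k + 1 := ⟨n - 1, by omega⟩
        obtain ⟨c, hc⟩ := hk
        rw [← Fin.cons_self_tail s] at hE
        have hdet : k * u - c * m = 1 := by linear_combination hc
        have hE2 := hE.trans (E.two _ _ k c m u hdet)
        have htm : t ^ (m : ℤ) = 1 := by rw [zpow_natCast]; exact pow_orderOf_eq_one t
        refine ⟨h ^ k * s 0 ^ c, H.mul_mem (H.zpow_mem hh _) (H.zpow_mem (hs 0) _),
          Fin.cons ((t ^ u * h) ^ (m : ℤ) * s 0 ^ u) (Fin.tail s), ?_, ?_⟩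
        rotate_left
        · have : (t ^ u * h) ^ k * s 0 ^ c = t * (h ^ k * s 0 ^ c) := by
            rw [mul_zpow, ← zpow_mul, show u * k = 1 + m * c by linear_combination hc,
              zpow_add, zpow_mul, htm]
            simp [mul_assoc]
          rw [this] at hE2
          exact hE2
        · intro i
          refine Fin.cases ?_ (fun i => ?_) i
          · simp only [Fin.cons_zero]
            rw [mul_zpow, zpow_comm, htm]
            simp only [one_zpow, one_mul]
            exact H.mul_mem (H.zpow_mem hh _) (H.zpow_mem (hs 0) _)
          · simpa [Fin.tail] using hs i.succ
    have hcl : Subgroup.closure (Set.range s') = H := by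
      refine le_antisymm (hsH hs') fun g hg => ?_
      have h1 : g ∈ Subgroup.zpowers t ⊔ H := Subgroup.mem_sup_right hg
      rw [← hσ, ← hE'.closure_eq, range_cons_closure, Subgroup.mem_sup] at h1
      obtain ⟨y, ⟨a, rfl⟩, z, hz, e⟩ := h1
      simp only at e
      have hz' := hsH hs' hz
      have hd : (m : ℤ) ∣ a := by
        apply hcan
        have : t ^ a = g * z⁻¹ * (h' ^ a)⁻¹ := by
          rw [← e, mul_zpow]; group
        rw [this]
        exact H.mul_mem (H.mul_mem hg (H.inv_mem hz')) (H.inv_mem (H.zpow_mem hh' _))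
      have : (t * h') ^ a = 1 := by
        obtain ⟨b, rfl⟩ := hd
        rw [zpow_mul, mul_zpow, zpow_natCast, zpow_natCast, hexp h' hh', pow_orderOf_eq_one]
        simp
      rw [this, one_mul] at e
      rwa [← e]
    have hE3 : E σ (Fin.cons t s') := by
      have := hE'.trans (E.transv (t * h') h'⁻¹ (by rw [hcl]; exact H.inv_mem hh'))
      simpa using this
    have hIH := ih n (by omega) (fun i => τ i.succ) (hind.comp (Fin.succ_injective r))
      (fun i => hnt _) (fun i j hij => hdvd _ _ (Fin.succ_le_succ_iff.2 hij)) (by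
        rcases hcase with h | h | ⟨i, hi, hi4⟩
        · left; omega
        · omega
        · right
          rcases Nat.eq_zero_or_pos r with hr | hr
          · exact Or.inl hr
          · right
            have hi0 : i ≠ 0 := by
              rintro rfl
              simp at hi; omega
            obtain ⟨j, rfl⟩ := Fin.exists_succ_eq.2 hi0
            exact ⟨j, by simpa using hi, hi4⟩) s' hcl
    have := hE3.trans (hIH.cons t)
    convert this using 1
    funext i
    refine Fin.cases ?_ (fun i => ?_) i
    · simp [pad, ht]
    · simp [pad]

end Stmt6

/-- If the minimal number `r` of generators of the finite abelian group `G` satisfies `r < n`,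
or the smallest invariant factor of `G` is at most `4`, then `GLₙ(ℤ)` acts transitively on
the set of generating `n`-tuples of `G`.  Here the invariant factor decomposition is given
by `τ : Fin r → G` with `G = ⟨τ₁⟩ × ⋯ × ⟨τ_r⟩`, `|τⱼ| ∣ |τᵢ|` for `i ≤ j`, and all `τᵢ ≠ 1`. -/
theorem stmt6 {G : Type*} [CommGroup G] [Finite G] (n r : ℕ) (hrn : r ≤ n)
    (τ : Fin r → G)
    (hindep : iSupIndep fun i => Subgroup.zpowers (τ i))
    (hsup : (⨆ i, Subgroup.zpowers (τ i)) = ⊤)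
    (hnontriv : ∀ i, τ i ≠ 1)
    (hdvd : ∀ i j : Fin r, i ≤ j → orderOf (τ j) ∣ orderOf (τ i))
    (hcase : r < n ∨ ∃ i, orderOf (τ i) ≤ 4) :
    ∀ σ σ' : Fin n → G, Subgroup.closure (Set.range σ) = ⊤ →
      Subgroup.closure (Set.range σ') = ⊤ →
      ∃ P : Matrix (Fin n) (Fin n) ℤ, IsUnit P.det ∧
        (fun j => ∏ i, σ i ^ P i j) = σ' := by
  intro σ σ' hσ hσ'
  have hc : r < n ∨ r = 0 ∨ ∃ i : Fin r, (i : ℕ) + 1 = r ∧ orderOf (τ i) ≤ 4 := by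
    rcases hcase with h | ⟨i, hi⟩
    · exact Or.inl h
    · right; right
      have hlt := i.isLt
      refine ⟨⟨r - 1, by omega⟩, by simp only; omega, le_trans (Nat.le_of_dvd ?_ (hdvd i _ ?_)) hi⟩
      · exact orderOf_pos (τ i)
      · rw [Fin.le_def]; simp only; omega
  have h1 := Stmt6.main r n hrn τ hindep hnontriv hdvd hc σ (by rw [hσ, hsup])
  have h2 := Stmt6.main r n hrn τ hindep hnontriv hdvd hc σ' (by rw [hσ', hsup])
  exact h1.trans h2.symm
end

section
/- Let L be a centreless Lie Λ-torus of type Δ over a field k of characteristic 0, with Λ finitely generated. If the central grading group Γ_Λ(L) has finite index s in Λ, then for every α ∈ Q and λ ∈ Λ, dim L_α^λ ≤ (1/2)|Δ^×| s, and dim L^λ ≤ (1/2)|Δ^×| s + |Δ^×|. -/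
/-- `f` is a coroot functional for `α` with respect to the set `Δ`. -/
def IsCoroot {k 𝒳 : Type*} [Field k] [AddCommGroup 𝒳] [Module k 𝒳]
    (Δ : Set 𝒳) (α : 𝒳) (f : Module.Dual k 𝒳) : Prop :=
  f α = 2 ∧ ∀ β ∈ Δ, β - f β • α ∈ Δ

/-- A finite irreducible root system (containing `0`) in `𝒳`, together with a choice of
coroot functional for each nonzero root. -/
structure RootSystemIn (k 𝒳 : Type*) [Field k] [AddCommGroup 𝒳] [Module k 𝒳] where
  Δ : Set 𝒳
  coroot : 𝒳 → Module.Dual k 𝒳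
  finite : Δ.Finite
  zero_mem : (0 : 𝒳) ∈ Δ
  span_eq : Submodule.span k Δ = ⊤
  isCoroot : ∀ α ∈ Δ, α ≠ 0 → IsCoroot Δ α (coroot α)
  pairing_int : ∀ α ∈ Δ, α ≠ 0 → ∀ β ∈ Δ, ∃ z : ℤ, coroot α β = (z : k)
  irreducible : ∀ A B : Set 𝒳, A ∪ B = Δ \ {0} → A ∩ B = ∅ →
    (∀ α ∈ A, ∀ β ∈ B, coroot β α = 0) → A = ∅ ∨ B = ∅

/-- A Lie `Λ`-torus of type `Δ`: a `Q × Λ`-graded Lie algebra (the grading being recorded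
by the family `g` of subspaces indexed by `𝒳 × Λ`, supported on `Δ`) satisfying the axioms
(LT1)–(LT4). -/
structure IsLieTorus {k 𝒳 Λ L : Type*} [Field k] [AddCommGroup 𝒳] [Module k 𝒳]
    [DecidableEq 𝒳] [AddCommGroup Λ] [DecidableEq Λ] [LieRing L] [LieAlgebra k L]
    (R : RootSystemIn k 𝒳) (g : 𝒳 → Λ → Submodule k L) : Prop where
  isInternal : DirectSum.IsInternal fun p : 𝒳 × Λ => g p.1 p.2
  bracket_mem : ∀ (α β : 𝒳) (lam mu : Λ), ∀ x ∈ g α lam, ∀ y ∈ g β mu,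
    ⁅x, y⁆ ∈ g (α + β) (lam + mu)
  supp_subset : ∀ (α : 𝒳) (lam : Λ), g α lam ≠ ⊥ → α ∈ R.Δ
  lt2i : ∀ α ∈ R.Δ, α ≠ 0 → (¬ ∃ γ ∈ R.Δ, α = (2 : k) • γ) → g α 0 ≠ ⊥
  lt2ii : ∀ (α : 𝒳) (lam : Λ), α ≠ 0 → g α lam ≠ ⊥ →
    ∃ e f : L, e ∈ g α lam ∧ f ∈ g (-α) (-lam) ∧
      g α lam = Submodule.span k {e} ∧ g (-α) (-lam) = Submodule.span k {f} ∧
      ∀ (β : 𝒳) (mu : Λ), ∀ x ∈ g β mu, ⁅⁅e, f⁆, x⁆ = R.coroot α β • x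
  lt3 : LieSubalgebra.lieSpan k L
    (⋃ α ∈ R.Δ \ {0}, ⋃ lam : Λ, (g α lam : Set L)) = ⊤
  lt4 : AddSubgroup.closure {lam : Λ | ∃ α : 𝒳, g α lam ≠ ⊥} = ⊤

section
variable {k 𝒳 Λ L : Type*} [Field k] [CharZero k] [AddCommGroup 𝒳] [Module k 𝒳]
  [DecidableEq 𝒳] [AddCommGroup Λ] [DecidableEq Λ] [LieRing L] [LieAlgebra k L]

/-- The `Λ`-homogeneous component `L^λ = ⊕_α L_α^λ`. -/
def Lup (g : 𝒳 → Λ → Submodule k L) (lam : Λ) : Submodule k L := ⨆ α : 𝒳, g α lam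

/-- The support of the centroid of `L` in `Λ`: those `γ` admitting a nonzero centroid
transformation shifting the `Λ`-grading by `γ`. -/
def centralSupp (g : 𝒳 → Λ → Submodule k L) : Set Λ :=
  {γ : Λ | ∃ c : L →ₗ[k] L, c ≠ 0 ∧ (∀ x y : L, c ⁅x, y⁆ = ⁅x, c y⁆) ∧
    ∀ lam : Λ, ∀ x ∈ Lup g lam, c x ∈ Lup g (lam + γ)}

theorem aux_self_neg (k : Type*) {M : Type*} [Field k] [CharZero k] [AddCommGroup M] [Module k M]
    {x : M} (h : x = -x) : x = 0 := by
  have h2 : (2 : k) • x = 0 := by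
    rw [two_smul]
    nth_rewrite 2 [h]
    exact add_neg_cancel x
  exact (smul_eq_zero.mp h2).resolve_left two_ne_zero

/-- Uniqueness of coroots. -/
theorem aux_coroot_unique (R : RootSystemIn k 𝒳) {α : 𝒳} {f f' : Module.Dual k 𝒳}
    (hf : IsCoroot R.Δ α f) (hf' : IsCoroot R.Δ α f') : f = f' := by
  refine Module.Dual.eq_of_preReflection_mapsTo (x := α) R.finite R.span_eq hf.1 ?_ hf'.1 ?_
  · intro β hβ
    simpa [Module.preReflection_apply] using hf.2 β hβ
  · intro β hβ
    simpa [Module.preReflection_apply] using hf'.2 β hβ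

theorem aux_neg_mem (R : RootSystemIn k 𝒳) {α : 𝒳} (hα : α ∈ R.Δ) : -α ∈ R.Δ := by
  by_cases h0 : α = 0
  · simpa [h0] using R.zero_mem
  · have h := R.isCoroot α hα h0
    have h2 := h.2 α hα
    rw [h.1] at h2
    have : α - (2 : k) • α = -α := by rw [two_smul]; abel
    rwa [this] at h2

/-- Symmetry of orthogonality. -/
theorem aux_orth_symm (R : RootSystemIn k 𝒳) {α β : 𝒳} (hα : α ∈ R.Δ) (hα0 : α ≠ 0)
    (hβ : β ∈ R.Δ) (hβ0 : β ≠ 0) (h : R.coroot α β = 0) : R.coroot β α = 0 := by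
  have ha := R.isCoroot α hα hα0
  have hb := R.isCoroot β hβ hβ0
  have key : IsCoroot R.Δ β (R.coroot β - R.coroot β α • R.coroot α) := by
    refine ⟨by simp [h, hb.1], ?_⟩
    intro γ hγ
    have h1 := ha.2 _ (hb.2 _ (ha.2 γ hγ))
    convert h1 using 1
    simp only [map_sub, map_smul, smul_eq_mul, LinearMap.sub_apply, LinearMap.smul_apply, h, ha.1]
    module
  have e := aux_coroot_unique R hb key
  have := congrArg (fun φ => φ α) e
  simp only [LinearMap.sub_apply, LinearMap.smul_apply, ha.1, smul_eq_mul] at this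
  linear_combination (1/2 : k) * this

/-- Separation: a vector killed by all coroots is zero. -/
theorem aux_sep (R : RootSystemIn k 𝒳) (δ : 𝒳)
    (h : ∀ ε ∈ R.Δ, ε ≠ 0 → R.coroot ε δ = 0) : δ = 0 := by
  classical
  let W : Set (𝒳 →ₗ[k] 𝒳) := {w | (∀ β ∈ R.Δ, w β ∈ R.Δ) ∧ w δ = δ}
  haveI : Finite R.Δ := R.finite
  have hW : Finite W := by
    refine Finite.of_injective
      (fun w : W => (fun β : R.Δ => (⟨w.1 β, w.2.1 β β.2⟩ : R.Δ))) ?_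
    intro w w' hww
    apply Subtype.ext
    refine LinearMap.ext_on R.span_eq ?_
    intro β hβ
    have := congrFun hww ⟨β, hβ⟩
    simpa using this
  haveI := Fintype.ofFinite W
  let A : 𝒳 →ₗ[k] 𝒳 := ∑ w : W, w.1
  have hA : A = 0 := by
    refine LinearMap.ext_on R.span_eq ?_
    intro β hβ
    by_cases h0 : β = 0
    · simp [h0]
    have hb := R.isCoroot β hβ h0
    let s : 𝒳 →ₗ[k] 𝒳 := LinearMap.id - (R.coroot β).smulRight β
    have hs : ∀ x, s x = x - R.coroot β x • β := fun x => by simp [s]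
    have hss : ∀ x, s (s x) = x := fun x => by
      simp only [hs, map_sub, map_smul, hb.1, smul_eq_mul]; module
    have hmem : ∀ w : W, w.1 ∘ₗ s ∈ W := by
      intro w
      refine ⟨fun γ hγ => ?_, ?_⟩
      · exact w.2.1 _ (by rw [hs]; exact hb.2 γ hγ)
      · simp [hs, h β hβ h0, w.2.2]
    let σ : W → W := fun w => ⟨w.1 ∘ₗ s, hmem w⟩
    have hσ : Function.Involutive σ := by
      intro w
      apply Subtype.ext
      ext x
      simp [σ, hss]
    have hsβ : s β = -β := by rw [hs, hb.1, two_smul]; abel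
    have e1 : A β = ∑ w : W, w.1 β := by simp [A]
    have e2 : ∑ w : W, w.1 β = ∑ w : W, (σ w).1 β :=
      (Equiv.sum_comp hσ.toPerm (fun w : W => w.1 β)).symm
    have e3 : ∑ w : W, (σ w).1 β = - ∑ w : W, w.1 β := by
      simp [σ, hsβ]
    have e4 : A β = - A β := by rw [e1]; exact e2.trans e3
    simpa using aux_self_neg k e4
  have hd : A δ = (Fintype.card W : k) • δ := by
    have : A δ = ∑ w : W, w.1 δ := by simp [A]
    rw [this, Finset.sum_congr rfl (fun w _ => w.2.2), Finset.sum_const, Finset.card_univ,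
      Nat.cast_smul_eq_nsmul]
  rw [hA] at hd
  haveI : Nonempty W := ⟨⟨LinearMap.id, fun β hβ => hβ, rfl⟩⟩
  have hc : (Fintype.card W : k) ≠ 0 := by
    exact_mod_cast Fintype.card_ne_zero
  have : (Fintype.card W : k) • δ = 0 := by simpa using hd.symm
  exact (smul_eq_zero.mp this).resolve_left hc

theorem aux_double (R : RootSystemIn k 𝒳) {γ : 𝒳} (hγ : γ ∈ R.Δ) (hγ0 : γ ≠ 0)
    (h2 : (2 : k) • γ ∈ R.Δ) : R.coroot ((2 : k) • γ) = (1/2 : k) • R.coroot γ := by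
  have h0 : (2 : k) • γ ≠ 0 := smul_ne_zero two_ne_zero hγ0
  have hg := R.isCoroot γ hγ hγ0
  refine aux_coroot_unique R (R.isCoroot _ h2 h0) ⟨by simp [hg.1], fun β hβ => ?_⟩
  convert hg.2 β hβ using 2
  simp only [LinearMap.smul_apply, smul_smul, smul_eq_mul]
  congr 1
  ring

/-- Every nonzero root is proportional to an indivisible one. -/
theorem aux_indiv (R : RootSystemIn k 𝒳) {g : 𝒳 → Λ → Submodule k L} (hLT : IsLieTorus R g)
    {ρ : 𝒳} (hρ : ρ ∈ R.Δ) (hρ0 : ρ ≠ 0) :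
    ∃ ρ' ∈ R.Δ, ρ' ≠ 0 ∧ (∃ a : k, a ≠ 0 ∧ ρ' = a • ρ) ∧
      (∃ b : k, b ≠ 0 ∧ R.coroot ρ = b • R.coroot ρ') ∧ g ρ' 0 ≠ ⊥ := by
  by_cases hd : ∃ γ ∈ R.Δ, ρ = (2 : k) • γ
  · obtain ⟨γ, hγ, rfl⟩ := hd
    have hγ0 : γ ≠ 0 := by rintro rfl; simp at hρ0
    have e := aux_double R hγ hγ0 hρ
    refine ⟨γ, hγ, hγ0, ⟨1/2, by norm_num, by simp [smul_smul]⟩, ⟨1/2, by norm_num, e⟩, ?_⟩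
    refine hLT.lt2i γ hγ hγ0 ?_
    rintro ⟨δ, hδ, rfl⟩
    have hδ0 : δ ≠ 0 := by rintro rfl; simp at hγ0
    have e' := aux_double R hδ hδ0 hγ
    obtain ⟨z, hz⟩ := R.pairing_int _ hρ hρ0 δ hδ
    rw [e, e'] at hz
    simp only [LinearMap.smul_apply, (R.isCoroot δ hδ hδ0).1, smul_eq_mul] at hz
    have h1 : (1 : k) = ((2 * z : ℤ) : k) := by
      push_cast
      linear_combination 2 * hz
    have h2 : (1 : ℤ) = 2 * z := by exact_mod_cast h1
    omega
  · exact ⟨ρ, hρ, hρ0, ⟨1, one_ne_zero, by simp⟩, ⟨1, one_ne_zero, by simp⟩,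
      hLT.lt2i ρ hρ hρ0 hd⟩

theorem aux_hom_ext {R : RootSystemIn k 𝒳} {g : 𝒳 → Λ → Submodule k L} (hLT : IsLieTorus R g)
    {φ ψ : L →ₗ[k] L} (h : ∀ α lam, ∀ x ∈ g α lam, φ x = ψ x) : φ = ψ := by
  have : LinearMap.eqLocus φ ψ = ⊤ := by
    rw [eq_top_iff, ← hLT.isInternal.submodule_iSup_eq_top]
    exact iSup_le fun p x hx => h p.1 p.2 x hx
  ext x
  have hx : x ∈ LinearMap.eqLocus φ ψ := by rw [this]; trivial
  exact hx

theorem aux_proj {R : RootSystemIn k 𝒳} {g : 𝒳 → Λ → Submodule k L} (hLT : IsLieTorus R g) :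
    ∃ π : 𝒳 × Λ → L →ₗ[k] L, (∀ p x, π p x ∈ g p.1 p.2) ∧
      (∀ p, ∀ x ∈ g p.1 p.2, π p x = x) ∧
      (∀ p q, p ≠ q → ∀ x ∈ g q.1 q.2, π p x = 0) ∧
      (∀ x, (∀ p, π p x = 0) → x = 0) := by
  classical
  letI D := hLT.isInternal.chooseDecomposition
  let ℳ := fun p : 𝒳 × Λ => g p.1 p.2
  refine ⟨fun p => (ℳ p).subtype ∘ₗ (DirectSum.component k _ _ p) ∘ₗ
    (DirectSum.decomposeLinearEquiv ℳ).toLinearMap, ?_, ?_, ?_, ?_⟩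
  · intro p x
    exact Submodule.coe_mem _
  · intro p x hx
    exact DirectSum.decompose_of_mem_same ℳ hx
  · intro p q hpq x hx
    exact DirectSum.decompose_of_mem_ne ℳ hx hpq.symm
  · intro x hx
    apply (DirectSum.decomposeLinearEquiv ℳ).injective
    rw [map_zero]
    refine DFinsupp.ext fun p => ?_
    exact Subtype.ext (hx p)

theorem aux_gen_top {R : RootSystemIn k 𝒳} {g : 𝒳 → Λ → Submodule k L} (hLT : IsLieTorus R g)
    (K : Submodule k L) (hK : ∀ x ∈ K, ∀ y ∈ K, ⁅x, y⁆ ∈ K)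
    (hg : ∀ α ∈ R.Δ, α ≠ 0 → ∀ lam, g α lam ≤ K) : K = ⊤ := by
  let K' : LieSubalgebra k L := { K with lie_mem' := fun {x y} hx hy => hK x hx y hy }
  have : LieSubalgebra.lieSpan k L
    (⋃ α ∈ R.Δ \ {0}, ⋃ lam : Λ, (g α lam : Set L)) ≤ K' := by
    rw [LieSubalgebra.lieSpan_le]
    intro x hx
    simp only [Set.mem_iUnion] at hx
    obtain ⟨α, hα, lam, hx⟩ := hx
    exact hg α hα.1 hα.2 lam hx
  rw [hLT.lt3] at this
  rw [eq_top_iff]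
  intro x _
  exact this (show x ∈ (⊤ : LieSubalgebra k L) from trivial)

/-- Graded simplicity. -/
theorem aux_simple {R : RootSystemIn k 𝒳} {g : 𝒳 → Λ → Submodule k L} (hLT : IsLieTorus R g)
    (hcentreless : ∀ z : L, (∀ x : L, ⁅z, x⁆ = 0) → z = 0)
    (K : Submodule k L) (hK : ∀ x : L, ∀ y ∈ K, ⁅x, y⁆ ∈ K)
    {α : 𝒳} {lam : Λ} {x : L} (hx : x ∈ g α lam) (hx0 : x ≠ 0) (hxK : x ∈ K) : K = ⊤ := by
  have hK' : ∀ y ∈ K, ∀ x : L, ⁅y, x⁆ ∈ K := fun y hy x => by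
    rw [← lie_skew]; exact K.neg_mem (hK x y hy)
  wlog hα : α ≠ 0 generalizing α lam x
  · have hα' : α = 0 := not_not.mp hα
    by_contra hne
    apply hx0
    apply hcentreless
    let C : Submodule k L := LinearMap.ker (LieAlgebra.ad k L x)
    have hC : C = ⊤ := by
      apply aux_gen_top hLT
      · intro y hy z hz
        simp only [C, LinearMap.mem_ker] at hy hz ⊢
        have hy' : ⁅x, y⁆ = 0 := hy
        have hz' : ⁅x, z⁆ = 0 := hz
        change ⁅x, ⁅y, z⁆⁆ = 0
        rw [leibniz_lie, hy', hz']; simp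
      · intro β hβ hβ0 mu y hy
        change ⁅x, y⁆ = 0
        by_contra hxy
        have hm := hLT.bracket_mem α β lam mu x hx y hy
        exact hne (this hm hxy (hK' x hxK y) (by simpa [hα'] using hβ0))
    intro y
    have : y ∈ C := by rw [hC]; trivial
    exact this
  have hb : ∀ {α : 𝒳} {lam : Λ} {x : L}, x ∈ g α lam → x ≠ 0 → x ∈ K → α ≠ 0 →
      ∀ β mu, R.coroot α β ≠ 0 → g β mu ≤ K := by
    intro α lam x hx hx0 hxK hα β mu hne y hy
    have hbot : g α lam ≠ ⊥ := fun h => hx0 (by rw [h] at hx; simpa using hx)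
    obtain ⟨e, f, he, hf, hes, hfs, hh⟩ := hLT.lt2ii α lam hα hbot
    have hx' := hx
    rw [hes, Submodule.mem_span_singleton] at hx'
    obtain ⟨a, ha⟩ := hx'
    have ha0 : a ≠ 0 := by rintro rfl; simp at ha; exact hx0 ha.symm
    have heK : e ∈ K := by
      have : e = a⁻¹ • x := by rw [← ha, smul_smul, inv_mul_cancel₀ ha0, one_smul]
      rw [this]; exact K.smul_mem _ hxK
    have h1 := hh β mu y hy
    have h2 : ⁅⁅e, f⁆, y⁆ ∈ K := hK' _ (hK' e heK f) y
    rw [h1] at h2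
    exact (Submodule.smul_mem_iff K hne).mp h2
  have hαΔ : α ∈ R.Δ := hLT.supp_subset α lam (fun h => hx0 (by rw [h] at hx; simpa using hx))
  let A : Set 𝒳 := {β | (β ∈ R.Δ ∧ β ≠ 0) ∧ ∀ ρ, R.coroot β ρ ≠ 0 → ∀ mu, g ρ mu ≤ K}
  have hαA : α ∈ A := ⟨⟨hαΔ, hα⟩, fun ρ hρ mu => hb hx hx0 hxK hα ρ mu hρ⟩
  have hirr := R.irreducible A ((R.Δ \ {0}) \ A)
    (Set.union_diff_cancel (fun β hβ => ⟨hβ.1.1, hβ.1.2⟩))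
    (Set.inter_diff_self _ _) (by
      rintro β ⟨⟨hβ, hβ0⟩, hβA⟩ ρ ⟨⟨hρ, hρ0⟩, hρA⟩
      by_contra hne
      apply hρA
      obtain ⟨ρ', hρ', hρ'0, ⟨a, ha, hae⟩, ⟨b, hb0, hbe⟩, hbot⟩ := aux_indiv R hLT hρ hρ0
      refine ⟨⟨hρ, hρ0⟩, fun σ hσ mu => ?_⟩
      obtain ⟨z, hz, hz0⟩ := Submodule.exists_mem_ne_zero_of_ne_bot hbot
      have h1 : R.coroot β ρ ≠ 0 := fun h => hne (aux_orth_symm R hβ hβ0 hρ hρ0 h)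
      have h2 : R.coroot β ρ' ≠ 0 := by
        rw [hae, map_smul]; exact smul_ne_zero ha h1
      refine hb hz hz0 (hβA ρ' h2 0 hz) hρ'0 σ mu ?_
      intro h
      apply hσ
      rw [hbe, LinearMap.smul_apply, h, smul_zero])
  have hB : (R.Δ \ {0}) \ A = ∅ := hirr.resolve_left (fun h => by rw [h] at hαA; exact hαA)
  apply aux_gen_top hLT K (fun x _ y hy => hK x y hy)
  intro β hβ hβ0 mu
  have hβA : β ∈ A := by
    by_contra h
    have : β ∈ (R.Δ \ {0}) \ A := ⟨⟨hβ, hβ0⟩, h⟩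
    rw [hB] at this
    exact this
  refine hβA.2 β ?_ mu
  rw [(R.isCoroot β hβ hβ0).1]
  exact two_ne_zero

theorem aux_homog {R : RootSystemIn k 𝒳} {g : 𝒳 → Λ → Submodule k L} (hLT : IsLieTorus R g)
    {c : L →ₗ[k] L} {γ : Λ} (hc : ∀ x y : L, c ⁅x, y⁆ = ⁅x, c y⁆)
    (hs : ∀ lam : Λ, ∀ x ∈ Lup g lam, c x ∈ Lup g (lam + γ))
    {α : 𝒳} {lam : Λ} {x : L} (hx : x ∈ g α lam) : c x ∈ g α (lam + γ) := by
  obtain ⟨π, hπm, hπs, hπn, hπ0⟩ := aux_proj hLT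
  have hcx : c x ∈ Lup g (lam + γ) := hs lam x (Submodule.mem_iSup_of_mem α hx)
  have key : ∀ p, p ≠ (α, lam + γ) → π p (c x) = 0 := by
    intro p hp
    by_contra hne
    have h2 : p.2 = lam + γ := by
      by_contra h2
      have : Lup g (lam + γ) ≤ LinearMap.ker (π p) := by
        refine iSup_le fun β y hy => ?_
        exact hπn p (β, lam + γ) (fun h => h2 (by rw [h])) y hy
      exact hne (this hcx)
    have h1 : p.1 - α = 0 := by
      apply aux_sep R
      intro ε hε hε0
      obtain ⟨ε', hε', hε'0, -, ⟨b, hb0, hbe⟩, hbot⟩ := aux_indiv R hLT hε hε0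
      obtain ⟨e, f, he, hf, -, -, hh⟩ := hLT.lt2ii ε' 0 hε'0 hbot
      have hcom : π p ∘ₗ (LieAlgebra.ad k L ⁅e, f⁆) = R.coroot ε' p.1 • π p := by
        apply aux_hom_ext hLT
        intro β mu y hy
        change π p ⁅⁅e, f⁆, y⁆ = R.coroot ε' p.1 • π p y
        rw [hh β mu y hy, map_smul]
        by_cases hpq : p = (β, mu)
        · rw [hpq]
        · rw [hπn p (β, mu) hpq y hy]; simp
      have e1 : π p ⁅⁅e, f⁆, c x⁆ = R.coroot ε' p.1 • π p (c x) :=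
        congrArg (fun φ => φ (c x)) hcom
      rw [← hc, hh α lam x hx, map_smul, map_smul] at e1
      have e2 : (R.coroot ε' p.1 - R.coroot ε' α) • π p (c x) = 0 := by
        rw [sub_smul, e1, sub_self]
      have e3 := (smul_eq_zero.mp e2).resolve_right hne
      rw [hbe, LinearMap.smul_apply, map_sub, e3, smul_zero]
    exact hp (Prod.ext (sub_eq_zero.mp h1) h2)
  have : c x = π (α, lam + γ) (c x) := by
    rw [← sub_eq_zero]
    apply hπ0
    intro p
    rw [map_sub]
    by_cases hp : p = (α, lam + γ)
    · rw [hp, hπs (α, lam + γ) _ (hπm _ _), sub_self]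
    · rw [key p hp, hπn p (α, lam + γ) hp _ (hπm _ _), sub_self]
  rw [this]
  exact hπm (α, lam + γ) _

theorem aux_inj {R : RootSystemIn k 𝒳} {g : 𝒳 → Λ → Submodule k L} (hLT : IsLieTorus R g)
    (hcentreless : ∀ z : L, (∀ x : L, ⁅z, x⁆ = 0) → z = 0)
    {c : L →ₗ[k] L} {γ : Λ} (hc0 : c ≠ 0) (hc : ∀ x y : L, c ⁅x, y⁆ = ⁅x, c y⁆)
    (hs : ∀ α lam, ∀ x ∈ g α lam, c x ∈ g α (lam + γ))
    {x : L} (hx : c x = 0) : x = 0 := by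
  obtain ⟨π, hπm, hπs, hπn, hπ0⟩ := aux_proj hLT
  apply hπ0
  intro p
  by_contra hne
  have hcom : c ∘ₗ π p = π (p.1, p.2 + γ) ∘ₗ c := by
    apply aux_hom_ext hLT
    intro β mu y hy
    simp only [LinearMap.comp_apply]
    by_cases hp : p = (β, mu)
    · subst hp
      rw [hπs _ y hy, hπs (β, mu + γ) _ (hs β mu y hy)]
    · rw [hπn p (β, mu) hp y hy, map_zero, hπn _ (β, mu + γ) _ _ (hs β mu y hy)]
      intro h
      apply hp
      simp only [Prod.mk.injEq, add_left_inj] at h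
      exact Prod.ext h.1 h.2
  have h1 : c (π p x) = 0 := by
    have := congrArg (fun φ => φ x) hcom
    simpa [hx] using this
  have htop := aux_simple hLT hcentreless (LinearMap.ker c) (fun y z hz => by
    rw [LinearMap.mem_ker] at hz ⊢
    rw [hc, hz, lie_zero]) (hπm p x) hne h1
  exact hc0 (LinearMap.ker_eq_top.mp htop)

/-- The generators of the degree-zero part. -/
theorem aux_zero {R : RootSystemIn k 𝒳} {g : 𝒳 → Λ → Submodule k L} (hLT : IsLieTorus R g)
    (lam : Λ) (V : Submodule k L)
    (hV : ∀ α ∈ R.Δ, α ≠ 0 → ∀ mu, ∀ x ∈ g α mu, ∀ y ∈ g (-α) (lam - mu), ⁅x, y⁆ ∈ V) :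
    g 0 lam ≤ V := by
  obtain ⟨π, hπm, hπs, hπn, hπ0⟩ := aux_proj hLT
  let S1 : Set L := {x | ∃ α mu, α ≠ 0 ∧ x ∈ g α mu}
  let S2 : Set L := {z | ∃ α mu nu x y, α ≠ 0 ∧ x ∈ g α mu ∧ y ∈ g (-α) nu ∧ z = ⁅x, y⁆}
  have h11 : ∀ x ∈ S1, ∀ y ∈ S1, ⁅x, y⁆ ∈ Submodule.span k (S1 ∪ S2) := by
    rintro x ⟨α, mu, hα, hx⟩ y ⟨β, nu, hβ, hy⟩
    apply Submodule.subset_span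
    by_cases h : α + β = 0
    · have : β = -α := (neg_eq_of_add_eq_zero_right h).symm
      subst this
      exact Or.inr ⟨α, mu, nu, x, y, hα, hx, hy, rfl⟩
    · exact Or.inl ⟨α + β, mu + nu, h, hLT.bracket_mem _ _ _ _ x hx y hy⟩
  have h2m : ∀ z ∈ S2, ∃ nu, z ∈ g 0 nu := by
    rintro z ⟨α, mu, nu, x, y, hα, hx, hy, rfl⟩
    refine ⟨mu + nu, ?_⟩
    have := hLT.bracket_mem _ _ _ _ x hx y hy
    rwa [add_neg_cancel] at this
  have h21 : ∀ z ∈ S2, ∀ α, α ≠ 0 → ∀ mu, ∀ x ∈ g α mu, ∃ nu, ⁅z, x⁆ ∈ g α nu := by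
    intro z hz α hα mu x hx
    obtain ⟨nu, hz⟩ := h2m z hz
    refine ⟨nu + mu, ?_⟩
    have := hLT.bracket_mem _ _ _ _ z hz x hx
    rwa [zero_add] at this
  have hgen : ∀ x ∈ S1 ∪ S2, ∀ y ∈ S1 ∪ S2, ⁅x, y⁆ ∈ Submodule.span k (S1 ∪ S2) := by
    rintro x (hx | hx) y (hy | hy)
    · exact h11 x hx y hy
    · obtain ⟨α, mu, hα, hx⟩ := hx
      obtain ⟨nu, h⟩ := h21 y hy α hα mu x hx
      rw [← lie_skew]
      exact Submodule.neg_mem _ (Submodule.subset_span (Or.inl ⟨α, nu, hα, h⟩))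
    · obtain ⟨α, mu, hα, hy⟩ := hy
      obtain ⟨nu, h⟩ := h21 x hx α hα mu y hy
      exact Submodule.subset_span (Or.inl ⟨α, nu, hα, h⟩)
    · obtain ⟨α, mu, nu, a, b, hα, ha, hb, rfl⟩ := hy
      rw [leibniz_lie]
      obtain ⟨nu1, h1⟩ := h21 x hx α hα mu a ha
      obtain ⟨nu2, h2⟩ := h21 x hx (-α) (neg_ne_zero.mpr hα) nu b hb
      exact Submodule.add_mem _
        (Submodule.subset_span (Or.inr ⟨α, nu1, nu, _, b, hα, h1, hb, rfl⟩))
        (Submodule.subset_span (Or.inr ⟨α, mu, nu2, a, _, hα, ha, h2, rfl⟩))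
  have htop : Submodule.span k (S1 ∪ S2) = ⊤ := by
    apply aux_gen_top hLT
    · intro x hx y hy
      induction hx using Submodule.span_induction with
      | mem x hx =>
        induction hy using Submodule.span_induction with
        | mem y hy => exact hgen x hx y hy
        | zero => simp
        | add y z _ _ h1 h2 => rw [lie_add]; exact Submodule.add_mem _ h1 h2
        | smul a y _ h1 => rw [lie_smul]; exact Submodule.smul_mem _ _ h1
      | zero => simp
      | add y z _ _ h1 h2 => rw [add_lie]; exact Submodule.add_mem _ h1 h2
      | smul a y _ h1 => rw [smul_lie]; exact Submodule.smul_mem _ _ h1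
    · intro α hα hα0 mu x hx
      exact Submodule.subset_span (Or.inl ⟨α, mu, hα0, hx⟩)
  have hle : Submodule.span k (S1 ∪ S2) ≤ V.comap (π (0, lam)) := by
    rw [Submodule.span_le]
    rintro z (⟨α, mu, hα, hz⟩ | ⟨α, mu, nu, x, y, hα, hx, hy, rfl⟩)
    · change π (0, lam) z ∈ V
      rw [hπn (0, lam) (α, mu) (fun h => hα (congrArg Prod.fst h).symm) z hz]
      exact V.zero_mem
    · change π (0, lam) ⁅x, y⁆ ∈ V
      have hm := hLT.bracket_mem _ _ _ _ x hx y hy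
      rw [add_neg_cancel] at hm
      by_cases h : mu + nu = lam
      · subst h
        rw [hπs (0, mu + nu) _ hm]
        by_cases hx0 : x = 0
        · simp [hx0]
        have hαΔ : α ∈ R.Δ :=
          hLT.supp_subset α mu (fun h => hx0 (by rw [h] at hx; simpa using hx))
        exact hV α hαΔ hα mu x hx y (by simpa using hy)
      · rw [hπn (0, lam) (0, mu + nu) (fun h' => h (congrArg Prod.snd h').symm) _ hm]
        exact V.zero_mem
  intro x hx
  have : x ∈ V.comap (π (0, lam)) := hle (by rw [htop]; trivial)
  rw [Submodule.mem_comap, hπs (0, lam) x hx] at this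
  exact this

theorem aux_line {R : RootSystemIn k 𝒳} {g : 𝒳 → Λ → Submodule k L} (hLT : IsLieTorus R g)
    {α : 𝒳} (hα : α ≠ 0) (lam : Λ) : ∃ e ∈ g α lam, g α lam = Submodule.span k {e} := by
  by_cases h : g α lam = ⊥
  · exact ⟨0, Submodule.zero_mem _, by simp [h]⟩
  · obtain ⟨e, f, he, hf, hes, -⟩ := hLT.lt2ii α lam hα h
    exact ⟨e, he, hes⟩

theorem aux_prop {R : RootSystemIn k 𝒳} {g : 𝒳 → Λ → Submodule k L} (hLT : IsLieTorus R g)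
    {α : 𝒳} (hα : α ≠ 0) {lam : Λ} {x y : L} (hx : x ∈ g α lam) (hy : y ∈ g α lam)
    (hy0 : y ≠ 0) : ∃ a : k, x = a • y := by
  obtain ⟨e, he, hes⟩ := aux_line hLT hα lam
  rw [hes, Submodule.mem_span_singleton] at hx hy
  obtain ⟨a, rfl⟩ := hx
  obtain ⟨b, rfl⟩ := hy
  have hb : b ≠ 0 := by rintro rfl; simp at hy0
  exact ⟨a * b⁻¹, by rw [smul_smul, mul_assoc, inv_mul_cancel₀ hb, mul_one]⟩

/-- For a fixed coset, all brackets lie on one line. -/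
theorem aux_coset {R : RootSystemIn k 𝒳} {g : 𝒳 → Λ → Submodule k L} (hLT : IsLieTorus R g)
    (hcentreless : ∀ z : L, (∀ x : L, ⁅z, x⁆ = 0) → z = 0)
    (lam : Λ) (α : 𝒳) (hα : α ≠ 0) (t : Λ) :
    ∃ v : L, ∀ mu, mu - t ∈ centralSupp g → ∀ x ∈ g α mu, ∀ y ∈ g (-α) (lam - mu),
      ⁅x, y⁆ ∈ Submodule.span k {v} := by
  by_cases hall : ∀ mu, mu - t ∈ centralSupp g → ∀ x ∈ g α mu, ∀ y ∈ g (-α) (lam - mu),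
      ⁅x, y⁆ = 0
  · exact ⟨0, fun mu hmu x hx y hy => by rw [hall mu hmu x hx y hy]; exact Submodule.zero_mem _⟩
  push Not at hall
  obtain ⟨mu0, hmu0, x0, hx0, y0, hy0, hne⟩ := hall
  refine ⟨⁅x0, y0⁆, fun mu hmu x hx y hy => ?_⟩
  obtain ⟨c0, hc00, hc0, hs0⟩ := hmu0
  obtain ⟨c, hcn, hc, hs⟩ := hmu
  have hx00 : x0 ≠ 0 := by rintro rfl; simp at hne
  have hy00 : y0 ≠ 0 := by rintro rfl; simp at hne
  have H0 := fun α lam x (hx : x ∈ g α lam) => aux_homog hLT hc0 hs0 hx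
  have H := fun α lam x (hx : x ∈ g α lam) => aux_homog hLT hc hs hx
  have I0 : ∀ x, c0 x = 0 → x = 0 := fun x => aux_inj hLT hcentreless hc00 hc0 H0
  have I : ∀ x, c x = 0 → x = 0 := fun x => aux_inj hLT hcentreless hcn hc H
  have hc0' : ∀ x y, c0 ⁅x, y⁆ = ⁅c0 x, y⁆ := fun x y => by
    rw [← lie_skew, map_neg, hc0, lie_skew]
  have hc' : ∀ x y, c ⁅x, y⁆ = ⁅c x, y⁆ := fun x y => by
    rw [← lie_skew, map_neg, hc, lie_skew]
  have m1 := H0 _ _ x hx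
  have m2 := H _ _ x0 hx0
  rw [show mu0 + (mu - t) = mu + (mu0 - t) by abel] at m2
  obtain ⟨a, ha⟩ := aux_prop hLT hα m1 m2 (fun h => hx00 (I _ h))
  have m3 := H _ _ y hy
  have m4 := H0 _ _ y0 hy0
  rw [show lam - mu0 + (mu0 - t) = lam - mu + (mu - t) by abel] at m4
  obtain ⟨b, hb⟩ := aux_prop hLT (neg_ne_zero.mpr hα) m3 m4 (fun h => hy00 (I0 _ h))
  rw [Submodule.mem_span_singleton]
  refine ⟨a * b, ?_⟩
  rw [← sub_eq_zero]
  apply I0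
  have e : c0 ⁅x, y⁆ = (a * b) • c0 ⁅x0, y0⁆ := by
    rw [hc0', ha, smul_lie, ← hc', hc, hb, lie_smul, smul_smul, ← hc0]
  rw [map_sub, map_smul, e, sub_self]

theorem aux_half (R : RootSystemIn k 𝒳) : ∃ P : Finset 𝒳, (∀ α ∈ P, α ≠ 0) ∧
    (∀ α ∈ R.Δ, α ≠ 0 → α ∈ P ∨ -α ∈ P) ∧ 2 * P.card ≤ (R.Δ \ {0}).ncard := by
  classical
  letI : LinearOrder 𝒳 := linearOrderOfSTO (WellOrderingRel (α := 𝒳))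
  have hfin : (R.Δ \ {0}).Finite := R.finite.subset Set.sdiff_subset
  let D := hfin.toFinset
  have hD : ∀ α, α ∈ D ↔ α ∈ R.Δ ∧ α ≠ 0 := fun α => by simp [D]
  let P := D.filter (fun α => α < -α)
  have hP : ∀ α, α ∈ P ↔ (α ∈ R.Δ ∧ α ≠ 0) ∧ α < -α := fun α => by
    simp only [P, Finset.mem_filter, hD]
  refine ⟨P, fun α h => ((hP α).mp h).1.2, fun α h h0 => ?_, ?_⟩
  · rcases lt_trichotomy α (-α) with h1 | h1 | h1
    · exact Or.inl ((hP α).mpr ⟨⟨h, h0⟩, h1⟩)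
    · exact absurd (aux_self_neg k h1) h0
    · exact Or.inr ((hP _).mpr ⟨⟨aux_neg_mem R h, neg_ne_zero.mpr h0⟩, by rwa [neg_neg]⟩)
  · have hdis : Disjoint P (P.image (fun α => -α)) := by
      rw [Finset.disjoint_left]
      intro α h1 h2
      obtain ⟨β, hβ, rfl⟩ := Finset.mem_image.mp h2
      have a1 := ((hP _).mp h1).2
      have a2 := ((hP _).mp hβ).2
      rw [neg_neg] at a1
      exact absurd a1 a2.asymm
    have hsub : P ∪ P.image (fun α => -α) ⊆ D := by
      intro α h
      rcases Finset.mem_union.mp h with h | h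
      · exact (hD _).mpr ((hP _).mp h).1
      · obtain ⟨β, hβ, rfl⟩ := Finset.mem_image.mp h
        have := ((hP _).mp hβ).1
        exact (hD _).mpr ⟨aux_neg_mem R this.1, neg_ne_zero.mpr this.2⟩
    have h1 := Finset.card_le_card hsub
    rw [Finset.card_union_of_disjoint hdis, Finset.card_image_of_injective _ neg_injective] at h1
    rw [Set.ncard_eq_toFinset_card _ hfin]
    change 2 * P.card ≤ D.card
    omega

theorem aux_rank {V : Submodule k L} {F : Finset L} {n : ℕ}
    (h : V ≤ Submodule.span k (F : Set L)) (hn : 2 * F.card ≤ n) :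
    2 * Module.rank k ↥V ≤ (n : Cardinal) := by
  have h1 : Module.rank k V ≤ (F.card : Cardinal) :=
    (Submodule.rank_mono h).trans (rank_span_finset_le F)
  calc 2 * Module.rank k V ≤ 2 * (F.card : Cardinal) := by gcongr
    _ = ((2 * F.card : ℕ) : Cardinal) := by push_cast; rfl
    _ ≤ n := by exact_mod_cast hn


/-- If `L` is a centreless Lie `Λ`-torus (`Λ` finitely generated) whose central grading
group has finite index (witnessed by `s = |T|` coset representatives), then
`dim L_α^λ ≤ ½|Δˣ| s` and `dim L^λ ≤ ½|Δˣ| s + |Δˣ|` for all `α ∈ Q`, `λ ∈ Λ`. -/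
theorem stmt14 (R : RootSystemIn k 𝒳) (g : 𝒳 → Λ → Submodule k L)
    (hLT : IsLieTorus R g) [AddGroup.FG Λ]
    (hcentreless : ∀ z : L, (∀ x : L, ⁅z, x⁆ = 0) → z = 0)
    (T : Finset Λ) (hT : ∀ lam : Λ, ∃ t ∈ T, lam - t ∈ centralSupp g) :
    (∀ (α : 𝒳) (lam : Λ),
      2 * Module.rank k ↥(g α lam) ≤ (((R.Δ \ {0}).ncard * T.card : ℕ) : Cardinal)) ∧
    (∀ lam : Λ,
      2 * Module.rank k ↥(Lup g lam) ≤
        (((R.Δ \ {0}).ncard * T.card + 2 * (R.Δ \ {0}).ncard : ℕ) : Cardinal)) := by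
  classical
  obtain ⟨P, hP0, hPc, hPcard⟩ := aux_half R
  have hline : ∀ lam : Λ, ∃ F : Finset L, F.card ≤ P.card * T.card ∧
      g 0 lam ≤ Submodule.span k (F : Set L) := by
    intro lam
    have hv : ∀ (α : 𝒳) (t : Λ), ∃ v : L, α ≠ 0 → ∀ mu, mu - t ∈ centralSupp g →
        ∀ x ∈ g α mu, ∀ y ∈ g (-α) (lam - mu), ⁅x, y⁆ ∈ Submodule.span k {v} := by
      intro α t
      by_cases hα : α = 0
      · exact ⟨0, fun h => absurd hα h⟩
      · obtain ⟨v, hv⟩ := aux_coset hLT hcentreless lam α hα t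
        exact ⟨v, fun _ => hv⟩
    choose v hv using hv
    refine ⟨(P ×ˢ T).image (fun p => v p.1 p.2), ?_, ?_⟩
    · exact Finset.card_image_le.trans (Finset.card_product P T).le
    · apply aux_zero hLT
      have hpos : ∀ α ∈ P, ∀ mu, ∀ x ∈ g α mu, ∀ y ∈ g (-α) (lam - mu), ⁅x, y⁆ ∈
          Submodule.span k (((P ×ˢ T).image (fun p => v p.1 p.2) : Finset L) : Set L) := by
        intro α hα mu x hx y hy
        obtain ⟨t, ht, hmt⟩ := hT mu
        refine Submodule.span_mono ?_ (hv α t (hP0 α hα) mu hmt x hx y hy)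
        rw [Set.singleton_subset_iff, Finset.mem_coe]
        exact Finset.mem_image_of_mem (fun p : 𝒳 × Λ => v p.1 p.2)
          (Finset.mem_product.mpr ⟨hα, ht⟩ : (α, t) ∈ P ×ˢ T)
      intro α hα hα0 mu x hx y hy
      rcases hPc α hα hα0 with h | h
      · exact hpos α h mu x hx y hy
      · rw [← lie_skew]
        refine Submodule.neg_mem _ (hpos (-α) h (lam - mu) y hy x ?_)
        rwa [neg_neg, sub_sub_cancel]
  obtain ⟨t0, ht0, -⟩ := hT 0
  have hTpos : 1 ≤ T.card := Finset.card_pos.mpr ⟨t0, ht0⟩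
  have hfin : (R.Δ \ {0}).Finite := R.finite.subset Set.sdiff_subset
  have hmul : 2 * (P.card * T.card) ≤ (R.Δ \ {0}).ncard * T.card := by
    rw [← mul_assoc]; exact Nat.mul_le_mul_right _ hPcard
  constructor
  · intro α lam
    by_cases hα : α = 0
    · subst hα
      obtain ⟨F, hF, hle⟩ := hline lam
      exact aux_rank hle (by omega)
    · by_cases hb : g α lam = ⊥
      · exact aux_rank (F := ∅) (by simp [hb]) (by simp)
      · obtain ⟨e, he, hes⟩ := aux_line hLT hα lam
        have hαΔ := hLT.supp_subset α lam hb
        refine aux_rank (F := {e}) (by simp [hes]) ?_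
        have hPpos : 1 ≤ P.card := by
          rcases hPc α hαΔ hα with h | h
          · exact Finset.card_pos.mpr ⟨_, h⟩
          · exact Finset.card_pos.mpr ⟨_, h⟩
        have : 1 ≤ P.card * T.card := Nat.mul_pos hPpos hTpos
        rw [Finset.card_singleton]
        omega
  · intro lam
    obtain ⟨F, hF, hle⟩ := hline lam
    have he : ∀ α : 𝒳, ∃ e : L, α ≠ 0 → g α lam = Submodule.span k {e} := by
      intro α
      by_cases hα : α = 0
      · exact ⟨0, fun h => absurd hα h⟩
      · obtain ⟨e, -, hes⟩ := aux_line hLT hα lam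
        exact ⟨e, fun _ => hes⟩
    choose e he using he
    refine aux_rank (F := F ∪ hfin.toFinset.image e) ?_ ?_
    · refine iSup_le fun α => ?_
      by_cases hα : α = 0
      · subst hα
        exact hle.trans (Submodule.span_mono (by simp))
      · by_cases hb : g α lam = ⊥
        · simp [hb]
        · rw [he α hα]
          apply Submodule.span_mono
          rw [Set.singleton_subset_iff, Finset.mem_coe]
          apply Finset.mem_union_right
          apply Finset.mem_image_of_mem
          simpa [hα] using hLT.supp_subset α lam hb
    · have h1 := Finset.card_union_le F (hfin.toFinset.image e)
      have h2 : (hfin.toFinset.image e).card ≤ (R.Δ \ {0}).ncard := by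
        rw [Set.ncard_eq_toFinset_card _ hfin]; exact Finset.card_image_le
      omega

end
end
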